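/- arXiv:1601.03438 — 3 statements merged into one kernel-verified Lean document; each statement's English description precedes it below -/
import Mathlib

section
/- Let M be an R-module projective in σ[M], semiprime, satisfying ACC on annihilators, and such that every nonzero submodule of M contains a uniform submodule. Then there is a bijection between a complete set of representatives of isomorphism classes of indecomposable χ(M)-torsion-free injective modules in σ[M] and the set of minimal prime in M submodules, given by E ↦ P where Ass_M(E) = {P}. -/
/- Common definitions: the category σ[M], projectivity in σ[M], the product
   K_M L of submodules, annihilators, prime/semiprime submodules, hereditary
   torsion theories, M-singular modules, etc., following the paper. -/

universe u v

section Defs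

variable (R : Type u) [Ring R]

/-- `N` belongs to `σ[M]`: `N` is isomorphic to a submodule of an `M`-generated
module, i.e. `N` embeds into a quotient of a direct sum of copies of `M`. -/
def InSigma (M : Type v) [AddCommGroup M] [Module R M]
    (N : Type v) [AddCommGroup N] [Module R N] : Prop :=
  ∃ (ι : Type v) (K : Submodule R (ι →₀ M)) (g : N →ₗ[R] ((ι →₀ M) ⧸ K)),
    Function.Injective g

/-- `M` is projective in `σ[M]`. -/
def ProjInSigma (M : Type v) [AddCommGroup M] [Module R M] : Prop :=
  ∀ (A B : Type v) [AddCommGroup A] [Module R A] [AddCommGroup B] [Module R B],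
    InSigma R M A → InSigma R M B →
      ∀ (p : A →ₗ[R] B), Function.Surjective p →
        ∀ f : M →ₗ[R] B, ∃ g : M →ₗ[R] A, p.comp g = f

variable (M : Type v) [AddCommGroup M] [Module R M]

/-- The product `K_M L = Σ { f(K) : f ∈ Hom_R(M, L) }` of submodules of `M`. -/
def prodM (K L : Submodule R M) : Submodule R M :=
  ⨆ f ∈ {f : M →ₗ[R] M | LinearMap.range f ≤ L}, Submodule.map f K

/-- `Ann_M(X) = ∩ { ker f : f ∈ Hom_R(M, X) }`. -/
def annM (X : Type v) [AddCommGroup X] [Module R X] : Submodule R M :=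
  ⨅ f : M →ₗ[R] X, LinearMap.ker f

/-- The right annihilator `Ann_M^r(N) = Σ { L ⊆ M : N_M L = 0 }`. -/
def annMr (N : Submodule R M) : Submodule R M :=
  sSup {L : Submodule R M | prodM R M N L = ⊥}

/-- A submodule is fully invariant if it is stable under all endomorphisms. -/
def IsFullyInvariant (N : Submodule R M) : Prop :=
  ∀ f : M →ₗ[R] M, Submodule.map f N ≤ N

/-- `M` is a semiprime module: `K_M K = 0` implies `K = 0`. -/
def IsSemiprime : Prop :=
  ∀ K : Submodule R M, prodM R M K K = ⊥ → K = ⊥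

/-- `P` is prime in `M`. -/
def PrimeIn (P : Submodule R M) : Prop :=
  P ≠ ⊤ ∧ IsFullyInvariant R M P ∧
    ∀ K L : Submodule R M, IsFullyInvariant R M K → IsFullyInvariant R M L →
      prodM R M K L ≤ P → K ≤ P ∨ L ≤ P

/-- `P` is a minimal prime in `M`. -/
def MinPrimeIn (P : Submodule R M) : Prop :=
  PrimeIn R M P ∧ ∀ Q : Submodule R M, PrimeIn R M Q → Q ≤ P → Q = P

/-- Powers of a submodule: `powM N k = N^(k+1)`, i.e. `powM N 0 = N` and
`powM N (k+1) = N_M (powM N k)`. -/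
def powM (N : Submodule R M) : ℕ → Submodule R M
  | 0 => N
  | k + 1 => prodM R M N (powM N k)

/-- The set of annihilator submodules `∩_{f ∈ X} ker f` for `X ⊆ End_R(M)`. -/
def AnnSet : Set (Submodule R M) :=
  {N | ∃ X : Set (M →ₗ[R] M), N = ⨅ f ∈ X, LinearMap.ker f}

/-- `M` satisfies ACC on annihilators. -/
def AccOnAnnihilators : Prop :=
  ∀ c : ℕ → Submodule R M, (∀ n, c n ∈ AnnSet R M) → Monotone c →
    ∃ n, ∀ m, n ≤ m → c m = c n

/-- `U` is a uniform submodule of `M`. -/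
def UniformSub (U : Submodule R M) : Prop :=
  U ≠ ⊥ ∧ ∀ A B : Submodule R M, A ≤ U → B ≤ U → A ≠ ⊥ → B ≠ ⊥ → A ⊓ B ≠ ⊥

end Defs

section Torsion

variable (R : Type u) [Ring R]

/-- A hereditary torsion theory, presented via its torsion class: a class of
modules closed under submodules, quotients, extensions, isomorphisms and
direct sums. -/
structure HTC : Type (max u (v + 1)) where
  torsion : ∀ (N : Type v) [AddCommGroup N] [Module R N], Prop
  closed_sub : ∀ (N : Type v) [AddCommGroup N] [Module R N],
    torsion N → ∀ K : Submodule R N, torsion K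
  closed_quot : ∀ (N : Type v) [AddCommGroup N] [Module R N],
    torsion N → ∀ K : Submodule R N, torsion (N ⧸ K)
  closed_ext : ∀ (N : Type v) [AddCommGroup N] [Module R N] (K : Submodule R N),
    torsion K → torsion (N ⧸ K) → torsion N
  closed_iso : ∀ (N N' : Type v) [AddCommGroup N] [Module R N]
    [AddCommGroup N'] [Module R N'], (N ≃ₗ[R] N') → torsion N → torsion N'
  closed_dsum : ∀ (ι : Type v) (F : ι → Type v) [DecidableEq ι]
    [∀ i, AddCommGroup (F i)] [∀ i, Module R (F i)],
    (∀ i, torsion (F i)) → torsion (DirectSum ι F)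

/-- `N` is `τ`-torsion-free. -/
def TorsionFreeFor (τ : HTC.{u, v} R) (N : Type v) [AddCommGroup N] [Module R N] : Prop :=
  ∀ K : Submodule R N, τ.torsion ↥K → K = ⊥

variable (M : Type v) [AddCommGroup M] [Module R M]

/-- `N` is `χ(M)`-torsion: torsion for some (hence for the greatest) hereditary
torsion theory for which `M` is torsion-free. -/
def ChiTorsion (N : Type v) [AddCommGroup N] [Module R N] : Prop :=
  ∃ τ : HTC.{u, v} R, TorsionFreeFor R τ M ∧ τ.torsion N

/-- `N` is `χ(M)`-torsion-free. -/
def ChiTorsionFree (N : Type v) [AddCommGroup N] [Module R N] : Prop :=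
  ∀ K : Submodule R N, ChiTorsion R M ↥K → K = ⊥

/-- `X` is `M`-singular: `X ≅ L/K` with `L ∈ σ[M]` and `K` essential in `L`. -/
def IsMSingular (X : Type v) [AddCommGroup X] [Module R X] : Prop :=
  ∃ (L : Type v) (iL : AddCommGroup L)
    (mL : @Module R L inferInstance iL.toAddCommMonoid),
    letI := iL
    letI := mL
    InSigma R M L ∧ ∃ K : Submodule R L,
      (∀ K' : Submodule R L, K' ≠ ⊥ → K ⊓ K' ≠ ⊥) ∧ Nonempty (X ≃ₗ[R] (L ⧸ K))

/-- The `M`-singular submodule `Z(M)` of `M`. -/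
def singularSub : Submodule R M :=
  sSup {K : Submodule R M | IsMSingular R M ↥K}

/-- `Ass_M(X)`: the set of primes in `M` associated to `X`. -/
def AssM (X : Type v) [AddCommGroup X] [Module R X] : Set (Submodule R M) :=
  {P | P ≠ ⊤ ∧ IsFullyInvariant R M P ∧
    ∃ L : Submodule R X, L ≠ ⊥ ∧
      ∀ L' : Submodule R X, L' ≠ ⊥ → L' ≤ L → annM R M ↥L' = P}

/-- `E` is an injective object of `σ[M]`. -/
def InjInSigma (E : Type v) [AddCommGroup E] [Module R E] : Prop :=
  InSigma R M E ∧
    ∀ (B : Type v) [AddCommGroup B] [Module R B], InSigma R M B →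
      ∀ (A : Submodule R B) (f : ↥A →ₗ[R] E),
        ∃ g : B →ₗ[R] E, ∀ a : A, g ↑a = f a

/-- `E` is an indecomposable module. -/
def Indecomp (E : Type v) [AddCommGroup E] [Module R E] : Prop :=
  (⊥ : Submodule R E) ≠ ⊤ ∧
    ∀ A B : Submodule R E, IsCompl A B → A = ⊥ ∨ A = ⊤

/-- `M` has finite uniform dimension: there is no infinite independent family
of nonzero submodules. -/
def FiniteUniformDimension : Prop :=
  ¬ ∃ f : ℕ → Submodule R M, (∀ n, f n ≠ ⊥) ∧
      ∀ n : ℕ, f n ⊓ (⨆ m ∈ {m : ℕ | m ≠ n}, f m) = ⊥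

/-- `M` is a continuous module (conditions C1 and C2). -/
def ContinuousModule : Prop :=
  (∀ N : Submodule R M, ∃ D : Submodule R M, (∃ D', IsCompl D D') ∧ N ≤ D ∧
      ∀ L : Submodule R M, L ≤ D → L ≠ ⊥ → N ⊓ L ≠ ⊥) ∧
  (∀ N D : Submodule R M, (∃ D', IsCompl D D') → Nonempty (↥N ≃ₗ[R] ↥D) →
      ∃ N', IsCompl N N')

end Torsion

section SigmaCategory

variable {R : Type u} [Ring R] {M : Type v} [AddCommGroup M] [Module R M]

theorem InSigma.of_injective {N N' : Type v} [AddCommGroup N] [Module R N]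
    [AddCommGroup N'] [Module R N'] (h : InSigma R M N') (f : N →ₗ[R] N')
    (hf : Function.Injective f) : InSigma R M N := by
  obtain ⟨ι, K, g, hg⟩ := h
  exact ⟨ι, K, g ∘ₗ f, hg.comp hf⟩

theorem InSigma.submodule {N : Type v} [AddCommGroup N] [Module R N]
    (h : InSigma R M N) (K : Submodule R N) : InSigma R M K :=
  h.of_injective K.subtype K.injective_subtype

variable (R M) in
theorem inSigma_finsupp (ι : Type v) : InSigma R M (ι →₀ M) :=
  ⟨ι, ⊥, (Submodule.quotEquivOfEqBot _ rfl).symm.toLinearMap, LinearEquiv.injective _⟩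

variable (R M) in
theorem inSigma_self : InSigma R M M :=
  (inSigma_finsupp R M PUnit).of_injective (Finsupp.lsingle PUnit.unit)
    (Finsupp.single_injective _)

theorem inSigma_finsupp_submodule (ι : Type v) (L : Submodule R M) :
    InSigma R M (ι →₀ L) :=
  (inSigma_finsupp R M ι).of_injective (Finsupp.mapRange.linearMap L.subtype)
    (Finsupp.mapRange_injective _ (map_zero _) L.injective_subtype)

theorem InSigma.range_finsupp {ι I : Type v} [AddCommGroup I] [Module R I]
    (f : (ι →₀ M) →ₗ[R] I) : InSigma R M (LinearMap.range f) :=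
  ⟨ι, LinearMap.ker f, f.quotKerEquivRange.symm.toLinearMap, LinearEquiv.injective _⟩

end SigmaCategory

section HomTorsion

variable {R : Type u} [Ring R] {M : Type v} [AddCommGroup M] [Module R M]

variable (R M) in
/-- `N` has no nonzero homomorphism from a submodule to `M`. -/
def HomTorsion (N : Type v) [AddCommGroup N] [Module R N] : Prop :=
  ∀ (K : Submodule R N) (f : K →ₗ[R] M), f = 0

theorem HomTorsion.eq_zero_of_ker_le {N B : Type v} [AddCommGroup N] [Module R N]
    [AddCommGroup B] [Module R B] (hN : HomTorsion R M N) (h : B →ₗ[R] N) (f : B →ₗ[R] M)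
    (hk : LinearMap.ker h ≤ LinearMap.ker f) : f = 0 := by
  have h0 := hN (LinearMap.range h)
    ((LinearMap.ker h).liftQ f hk ∘ₗ h.quotKerEquivRange.symm.toLinearMap)
  ext x
  have := LinearMap.congr_fun h0 (h.quotKerEquivRange (Submodule.Quotient.mk x))
  simpa using this

theorem HomTorsion.submodule {N : Type v} [AddCommGroup N] [Module R N]
    (hN : HomTorsion R M N) (K : Submodule R N) : HomTorsion R M K := fun K' f =>
  hN.eq_zero_of_ker_le (K.subtype ∘ₗ K'.subtype) f (by
    have hinj : Function.Injective (K.subtype ∘ₗ K'.subtype) :=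
      K.injective_subtype.comp K'.injective_subtype
    rw [LinearMap.ker_eq_bot.2 hinj]
    exact bot_le)

theorem HomTorsion.of_surjective {N N' : Type v} [AddCommGroup N] [Module R N]
    [AddCommGroup N'] [Module R N'] (hN : HomTorsion R M N) (p : N →ₗ[R] N')
    (hp : Function.Surjective p) : HomTorsion R M N' := by
  intro K f
  have h0 := hN (K.comap p) (f ∘ₗ p.restrict (fun x hx => hx))
  ext ⟨y, hy⟩
  obtain ⟨x, rfl⟩ := hp y
  exact LinearMap.congr_fun h0 ⟨x, hy⟩

theorem HomTorsion.extension {N : Type v} [AddCommGroup N] [Module R N] (K : Submodule R N)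
    (hK : HomTorsion R M K) (hQ : HomTorsion R M (N ⧸ K)) : HomTorsion R M N := by
  intro A f
  refine hQ.eq_zero_of_ker_le (K.mkQ ∘ₗ A.subtype) f ?_
  rintro ⟨a, ha⟩ hx
  have haK : a ∈ K := by simpa using hx
  have h0 := hK (A.comap K.subtype) (f ∘ₗ K.subtype.restrict (fun x hx => hx))
  exact LinearMap.congr_fun h0 ⟨⟨a, haK⟩, ha⟩

theorem HomTorsion.directSum (ι : Type v) (F : ι → Type v) [DecidableEq ι]
    [∀ i, AddCommGroup (F i)] [∀ i, Module R (F i)] (hF : ∀ i, HomTorsion R M (F i)) :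
    HomTorsion R M (DirectSum ι F) := by
  have key : ∀ (s : Finset ι) (A : Submodule R (DirectSum ι F)),
      (∀ x ∈ A, ∀ i ∉ s, x i = 0) → ∀ f : A →ₗ[R] M, f = 0 := by
    intro s
    induction s using Finset.induction_on with
    | empty =>
      intro A hA f
      ext ⟨x, hx⟩
      have : x = 0 := DFinsupp.ext fun i => hA x hx i (by simp)
      subst this
      exact map_zero f
    | insert j s hj ih =>
      intro A hA f
      refine (hF j).eq_zero_of_ker_le (DirectSum.component R ι F j ∘ₗ A.subtype) f ?_
      rintro ⟨x, hx⟩ hk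
      have hxj : x j = 0 := hk
      have h0 := ih (A ⊓ LinearMap.ker (DirectSum.component R ι F j)) (by
        rintro y ⟨hy, hyj⟩ i hi
        by_cases hij : i = j
        · subst hij
          exact hyj
        · exact hA y hy i (by simp [hij, hi]))
        (f ∘ₗ Submodule.inclusion inf_le_left)
      exact LinearMap.congr_fun h0 ⟨x, hx, hxj⟩
  intro A f
  ext ⟨x, hx⟩
  classical
  have h0 := key (DFinsupp.support x) (Submodule.span R {x}) (by
    intro y hy i hi
    obtain ⟨r, rfl⟩ := Submodule.mem_span_singleton.1 hy
    have hxi : x i = 0 := by simpa using hi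
    rw [DirectSum.smul_apply, hxi, smul_zero])
    (f ∘ₗ Submodule.inclusion (by simpa using hx))
  exact LinearMap.congr_fun h0 ⟨x, Submodule.mem_span_singleton_self x⟩

variable (R M) in
/-- The hereditary torsion theory cogenerated by `M`. -/
def homTorsionTheory : HTC.{u, v} R where
  torsion N _ _ := HomTorsion R M N
  closed_sub _ _ _ h K := h.submodule K
  closed_quot _ _ _ h K := h.of_surjective K.mkQ K.mkQ_surjective
  closed_ext _ _ _ K hK hQ := HomTorsion.extension K hK hQ
  closed_iso _ _ _ _ _ _ e h := h.of_surjective e.toLinearMap e.surjective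
  closed_dsum ι F _ _ _ h := HomTorsion.directSum ι F h

theorem torsionFreeFor_homTorsionTheory : TorsionFreeFor R (homTorsionTheory R M) M := by
  intro K hK
  have h0 := hK ⊤ (K.subtype ∘ₗ (⊤ : Submodule R K).subtype)
  rw [eq_bot_iff]
  intro x hx
  exact LinearMap.congr_fun h0 ⟨⟨x, hx⟩, trivial⟩

theorem ChiTorsion.hom_eq_zero {N : Type v} [AddCommGroup N] [Module R N]
    (h : ChiTorsion R M N) (f : N →ₗ[R] M) : f = 0 := by
  obtain ⟨τ, hM, hN⟩ := h
  rw [← LinearMap.range_eq_bot]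
  exact hM _ (τ.closed_iso _ _ f.quotKerEquivRange (τ.closed_quot _ hN _))

theorem ChiTorsionFree.exists_hom_ne_zero {E : Type v} [AddCommGroup E] [Module R E]
    (h : ChiTorsionFree R M E) (hE : (⊥ : Submodule R E) ≠ ⊤) :
    ∃ (K : Submodule R E) (f : K →ₗ[R] M), f ≠ 0 := by
  by_contra! hf
  exact hE (h ⊤ ⟨homTorsionTheory R M, torsionFreeFor_homTorsionTheory,
    HomTorsion.submodule (N := E) hf ⊤⟩).symm

end HomTorsion

section Complement

/-- Any element disjoint from `a` lies below a maximal one. -/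
theorem exists_le_maximal_disjoint {α : Type*} [CompleteLattice α] [IsCompactlyGenerated α]
    (a b : α) (hab : Disjoint a b) : ∃ c, b ≤ c ∧ Maximal (Disjoint a) c := by
  refine zorn_le_nonempty₀ {c | Disjoint a c} ?_ b hab
  intro s hs hchain y hy
  exact ⟨sSup s, hchain.directedOn.disjoint_sSup_right.2 fun x hx => hs hx,
    fun z hz => le_sSup hz⟩

variable {R : Type u} [Ring R] {M : Type v} [AddCommGroup M] [Module R M]

/-- In an injective object of `σ[M]`, every submodule is essential in a direct summand. -/
theorem InjInSigma.exists_isCompl_essential {E : Type v} [AddCommGroup E] [Module R E]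
    (hE : InjInSigma R M E) (L : Submodule R E) :
    ∃ A B : Submodule R E, IsCompl A B ∧ L ≤ A ∧ ∀ X ≤ A, Disjoint L X → X = ⊥ := by
  obtain ⟨B, -, hB⟩ := exists_le_maximal_disjoint L ⊥ disjoint_bot_right
  obtain ⟨A, hLA, hA⟩ := exists_le_maximal_disjoint B L hB.prop.symm
  have hess : ∀ X ≤ A, Disjoint L X → X = ⊥ := by
    intro X hXA hLX
    have h1 : Disjoint L (X ⊔ B) := by
      rw [Submodule.disjoint_def]
      intro l hl hlXB
      obtain ⟨x, hx, b, hb, rfl⟩ := Submodule.mem_sup.1 hlXB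
      have hbA : b ∈ A := by
        simpa using A.sub_mem (hLA hl) (hXA hx)
      have hb0 : b = 0 := Submodule.disjoint_def.1 hA.prop b hb hbA
      subst hb0
      rw [add_zero] at hl ⊢
      exact Submodule.disjoint_def.1 hLX x hl hx
    have h2 : X ≤ B := le_sup_left.trans (hB.le_of_ge h1 le_sup_right)
    exact (hA.prop.mono_left h2).eq_bot_of_le hXA
  refine ⟨A, B, ?_, hLA, hess⟩
  obtain ⟨g, hgA, hgB⟩ : ∃ g : E →ₗ[R] E, (∀ a ∈ A, g a = a) ∧ ∀ b ∈ B, g b = 0 := by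
    let e : A →ₗ[R] ((A ⊔ B : Submodule R E) ⧸ B.comap (A ⊔ B).subtype) :=
      (B.comap (A ⊔ B).subtype).mkQ ∘ₗ Submodule.inclusion le_sup_left
    have he : Function.Bijective e := by
      constructor
      · rw [injective_iff_map_eq_zero]
        rintro ⟨a, ha⟩ h
        have : a ∈ B := by simpa [e] using h
        exact Subtype.ext (Submodule.disjoint_def.1 hA.prop a this ha)
      · intro y
        obtain ⟨⟨x, hx⟩, rfl⟩ := Submodule.mkQ_surjective _ y
        obtain ⟨a, ha, b, hb, rfl⟩ := Submodule.mem_sup.1 hx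
        refine ⟨⟨a, ha⟩, ?_⟩
        simp only [e, LinearMap.comp_apply, Submodule.mkQ_apply]
        rw [Submodule.Quotient.eq]
        simpa using hb
    obtain ⟨g, hg⟩ := hE.2 E hE.1 (A ⊔ B)
      (A.subtype ∘ₗ (LinearEquiv.ofBijective e he).symm.toLinearMap ∘ₗ
        (B.comap (A ⊔ B).subtype).mkQ)
    refine ⟨g, fun a ha => ?_, fun b hb => ?_⟩
    · have h1 := hg ⟨a, le_sup_left (a := A) ha⟩
      have h2 : (B.comap (A ⊔ B).subtype).mkQ ⟨a, le_sup_left (a := A) ha⟩ =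
          LinearEquiv.ofBijective e he ⟨a, ha⟩ := rfl
      simp only [LinearMap.comp_apply, h2, LinearEquiv.coe_coe,
        LinearEquiv.symm_apply_apply] at h1
      exact h1
    · have h1 := hg ⟨b, le_sup_right (a := A) hb⟩
      have h2 : (B.comap (A ⊔ B).subtype).mkQ ⟨b, le_sup_right (a := A) hb⟩ = 0 := by
        simpa using hb
      simp only [LinearMap.comp_apply, h2, map_zero] at h1
      exact h1
  have hker : LinearMap.ker g = B := by
    refine le_antisymm (hB.le_of_ge ?_ hgB) hgB
    rw [Submodule.disjoint_def]
    intro x hx hgx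
    rw [← hgA x (hLA hx)]
    exact hgx
  have hrange : LinearMap.range g ≤ A := by
    refine hA.le_of_ge ?_ fun a ha => ⟨a, hgA a ha⟩
    have h1 : Disjoint L ((LinearMap.range g ⊓ B).comap g) := by
      rw [Submodule.disjoint_def]
      intro x hx hgx
      have : x ∈ B := by
        rw [← hgA x (hLA hx)]
        exact hgx.2
      exact Submodule.disjoint_def.1 hB.prop x hx this
    have h2 : (LinearMap.range g ⊓ B).comap g ≤ B := by
      refine hB.le_of_ge h1 fun b hb => ?_
      simp [hgB b hb]
    rw [Submodule.disjoint_def]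
    rintro _ hyB ⟨x, rfl⟩
    have : x ∈ B := h2 ⟨⟨x, rfl⟩, hyB⟩
    exact hgB x this
  refine ⟨hA.prop.symm, codisjoint_iff.2 (eq_top_iff.2 fun x _ => ?_)⟩
  have hgx : g x ∈ A := hrange ⟨x, rfl⟩
  refine Submodule.mem_sup.2 ⟨g x, hgx, x - g x, ?_, by abel⟩
  rw [← hker, LinearMap.mem_ker, map_sub, hgA _ hgx, sub_self]

end Complement

section Hull

/-- A linear map over `S` is linear over any ring acting through `S`. -/
def LinearMap.restrictAlong {R S X Y : Type*} [Ring R] [Ring S] [AddCommGroup X]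
    [AddCommGroup Y] [Module R X] [Module S X] [Module R Y] [Module S Y] (φ : R →+* S)
    (hX : ∀ (r : R) (x : X), r • x = φ r • x)
    (hY : ∀ (r : R) (y : Y), r • y = φ r • y) (f : X →ₗ[S] Y) : X →ₗ[R] Y where
  toFun := f
  map_add' := map_add f
  map_smul' r x := by rw [hX, map_smul, hY, RingHom.id_apply]

theorem exists_injective_embedding (S : Type v) [Ring S] (X : Type v) [AddCommGroup X]
    [Module S X] : ∃ (I : Type v) (_ : AddCommGroup I) (_ : Module S I),
      Module.Injective S I ∧ ∃ i : X →ₗ[S] I, Function.Injective i := by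
  obtain ⟨p⟩ := CategoryTheory.EnoughInjectives.presentation (ModuleCat.of S X)
  have hp := p.injective
  have hm := p.mono
  exact ⟨p.J, inferInstance, inferInstance,
    Module.injective_module_of_injective_object S p.J, p.f.hom,
    (ModuleCat.mono_iff_injective p.f).1 hm⟩

variable {R : Type u} [Ring R] {M : Type v} [AddCommGroup M] [Module R M]

variable (R M) in
/-- The trace of `M` in `I`. -/
noncomputable def moduleTrace (I : Type v) [AddCommGroup I] [Module R I] : Submodule R I :=
  LinearMap.range (Finsupp.lsum ℕ fun f : M →ₗ[R] I => f)

theorem range_le_moduleTrace {I : Type v} [AddCommGroup I] [Module R I] (f : M →ₗ[R] I) :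
    LinearMap.range f ≤ moduleTrace R M I := by
  rintro _ ⟨x, rfl⟩
  exact ⟨Finsupp.single f x, by simp⟩

theorem range_finsupp_le_moduleTrace {I : Type v} [AddCommGroup I] [Module R I] {ι : Type v}
    (f : (ι →₀ M) →ₗ[R] I) : LinearMap.range f ≤ moduleTrace R M I := by
  rintro _ ⟨x, rfl⟩
  induction x using Finsupp.induction_linear with
  | zero => simp
  | add a b ha hb =>
    rw [map_add]
    exact add_mem ha hb
  | single i m => exact range_le_moduleTrace (f ∘ₗ Finsupp.lsingle i) ⟨m, rfl⟩

/-- The trace of `M` in a module that is injective relative to all direct sums of copies of `M`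
is injective in `σ[M]`. -/
theorem injInSigma_moduleTrace {I : Type v} [AddCommGroup I] [Module R I]
    (hI : ∀ (ι : Type v) (C : Submodule R (ι →₀ M)) (f : C →ₗ[R] I),
      ∃ g : (ι →₀ M) →ₗ[R] I, ∀ c : C, g c = f c) :
    InjInSigma R M (moduleTrace R M I) := by
  refine ⟨InSigma.range_finsupp _, ?_⟩
  rintro B _ _ ⟨ι, K, j, hj⟩ A f
  let ja : A →ₗ[R] ((ι →₀ M) ⧸ K) := j ∘ₗ A.subtype
  have hja : Function.Injective ja := hj.comp A.injective_subtype
  let e := LinearEquiv.ofInjective ja hja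
  let C : Submodule R (ι →₀ M) := (LinearMap.range ja).comap K.mkQ
  let q : C →ₗ[R] LinearMap.range ja := K.mkQ.restrict fun x hx => hx
  obtain ⟨g, hg⟩ := hI ι C ((moduleTrace R M I).subtype ∘ₗ f ∘ₗ e.symm.toLinearMap ∘ₗ q)
  have hK : K ≤ LinearMap.ker g := by
    intro x hx
    have hx0 : K.mkQ x = 0 := by simpa using hx
    have hxC : x ∈ C := by
      rw [Submodule.mem_comap, hx0]
      exact zero_mem _
    have hq : q ⟨x, hxC⟩ = 0 := Subtype.ext hx0
    have := hg ⟨x, hxC⟩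
    rw [LinearMap.mem_ker, this]
    simp [hq]
  have hrange : ∀ y, K.liftQ g hK y ∈ moduleTrace R M I := by
    intro y
    obtain ⟨x, rfl⟩ := K.mkQ_surjective y
    exact range_finsupp_le_moduleTrace g ⟨x, rfl⟩
  refine ⟨((K.liftQ g hK).codRestrict _ hrange) ∘ₗ j, fun a => Subtype.ext ?_⟩
  obtain ⟨x, hx⟩ := K.mkQ_surjective (j a)
  have hxC : x ∈ C := by
    rw [Submodule.mem_comap, hx]
    exact ⟨a, rfl⟩
  have hq : q ⟨x, hxC⟩ = e a := Subtype.ext hx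
  have := hg ⟨x, hxC⟩
  simp only [LinearMap.comp_apply, LinearMap.codRestrict_apply, ← hx]
  rw [Submodule.mkQ_apply, Submodule.liftQ_apply, this]
  simp [hq]

variable (R M) in
/-- `M` embeds into an injective object of `σ[M]`. -/
theorem exists_injInSigma_embedding :
    ∃ (E : Type v) (_ : AddCommGroup E) (_ : Module R E), InjInSigma R M E ∧
      ∃ i : M →ₗ[R] E, Function.Injective i := by
  let φ := (Module.toAddMonoidEnd R M).rangeRestrict
  have hφ : Function.Surjective φ := (Module.toAddMonoidEnd R M).rangeRestrict_surjective
  obtain ⟨I, _, _, hinj, i, hi⟩ :=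
    exists_injective_embedding (Module.toAddMonoidEnd R M).range M
  let _ : Module R I := Module.compHom I φ
  have hM : ∀ (r : R) (x : M), r • x = φ r • x := fun _ _ => rfl
  have hI : ∀ (r : R) (x : I), r • x = φ r • x := fun _ _ => rfl
  let i' : M →ₗ[R] I := i.restrictAlong φ hM hI
  refine ⟨moduleTrace R M I, inferInstance, inferInstance, injInSigma_moduleTrace ?_,
    i'.codRestrict _ (fun x => range_le_moduleTrace i' ⟨x, rfl⟩),
    fun x y h => hi (congrArg Subtype.val h)⟩
  intro ι C f
  have hF : ∀ (r : R) (x : ι →₀ M), r • x = φ r • x := fun r x => by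
    ext k
    exact hM r (x k)
  let C' : Submodule (Module.toAddMonoidEnd R M).range (ι →₀ M) :=
    { C with
      smul_mem' := fun s x hx => by
        obtain ⟨r, rfl⟩ := hφ s
        rw [← hF]
        exact C.smul_mem r hx }
  let f' : C' →ₗ[(Module.toAddMonoidEnd R M).range] I :=
    { toFun := f
      map_add' := map_add f
      map_smul' := fun s x => by
        obtain ⟨r, rfl⟩ := hφ s
        exact map_smul f r (x : C) }
  obtain ⟨g, hg⟩ := hinj.out C'.subtype C'.injective_subtype f'
  exact ⟨g.restrictAlong φ hF hI, hg⟩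

theorem InjInSigma.of_isCompl {E : Type v} [AddCommGroup E] [Module R E]
    (hE : InjInSigma R M E) {A B : Submodule R E} (h : IsCompl A B) : InjInSigma R M A := by
  refine ⟨hE.1.submodule A, fun X _ _ hX Y f => ?_⟩
  obtain ⟨g, hg⟩ := hE.2 X hX Y (A.subtype ∘ₗ f)
  refine ⟨A.projectionOnto B h ∘ₗ g, fun y => ?_⟩
  simp [hg]

/-- Every submodule of `M` is essential in some injective object of `σ[M]`. -/
theorem exists_injective_hull (L : Submodule R M) :
    ∃ (E : Type v) (_ : AddCommGroup E) (_ : Module R E), InjInSigma R M E ∧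
      ∃ i : L →ₗ[R] E, Function.Injective i ∧
        ∀ X : Submodule R E, Disjoint (LinearMap.range i) X → X = ⊥ := by
  obtain ⟨E, _, _, hE, i, hi⟩ := exists_injInSigma_embedding R M
  obtain ⟨A, B, hAB, hLA, hess⟩ := hE.exists_isCompl_essential (L.map i)
  refine ⟨A, inferInstance, inferInstance, hE.of_isCompl hAB,
    (i ∘ₗ L.subtype).codRestrict A fun x => hLA ⟨x, x.2, rfl⟩,
    fun x y h => Subtype.ext (hi (congrArg Subtype.val h)), fun X hX => ?_⟩
  have h1 := hess (X.map A.subtype) (Submodule.map_subtype_le A X) (by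
    rw [Submodule.disjoint_def]
    rintro _ ⟨l, hl, rfl⟩ ⟨x, hx, hxl⟩
    have hx0 := Submodule.disjoint_def.1 hX x ⟨⟨l, hl⟩, Subtype.ext hxl.symm⟩ hx
    rw [← hxl, hx0, map_zero])
  rw [eq_bot_iff]
  intro x hx
  have : A.subtype x ∈ X.map A.subtype := ⟨x, hx, rfl⟩
  rw [h1] at this
  exact Subtype.ext this

end Hull

section Annihilator

variable {R : Type u} [Ring R] {M : Type v} [AddCommGroup M] [Module R M]

theorem mem_annM {X : Type v} [AddCommGroup X] [Module R X] {m : M} :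
    m ∈ annM R M X ↔ ∀ f : M →ₗ[R] X, f m = 0 := by
  simp [annM]

theorem annM_le_of_injective {X Y : Type v} [AddCommGroup X] [Module R X] [AddCommGroup Y]
    [Module R Y] (i : X →ₗ[R] Y) (hi : Function.Injective i) : annM R M Y ≤ annM R M X := by
  intro m hm
  rw [mem_annM] at hm ⊢
  intro f
  exact hi (by rw [map_zero]; exact hm (i ∘ₗ f))

theorem annM_congr {X Y : Type v} [AddCommGroup X] [Module R X] [AddCommGroup Y]
    [Module R Y] (e : X ≃ₗ[R] Y) : annM R M X = annM R M Y :=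
  le_antisymm (annM_le_of_injective e.symm.toLinearMap e.symm.injective)
    (annM_le_of_injective e.toLinearMap e.injective)

theorem isFullyInvariant_annM (X : Type v) [AddCommGroup X] [Module R X] :
    IsFullyInvariant R M (annM R M X) := by
  rintro g _ ⟨m, hm, rfl⟩
  exact mem_annM.2 fun f => mem_annM.1 hm (f ∘ₗ g)

theorem annM_submodule_mem_annSet (L : Submodule R M) : annM R M L ∈ AnnSet R M := by
  refine ⟨{f | LinearMap.range f ≤ L}, ?_⟩
  ext m
  simp only [mem_annM, Submodule.mem_iInf, LinearMap.mem_ker, Set.mem_ofPred_eq]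
  constructor
  · intro h f hf
    exact congrArg Subtype.val (h (f.codRestrict L fun x => hf ⟨x, rfl⟩))
  · intro h f
    refine Subtype.ext (h (L.subtype ∘ₗ f) ?_)
    rintro _ ⟨x, rfl⟩
    exact (f x).2

theorem sInf_mem_annSet {T : Set (Submodule R M)} (hT : T ⊆ AnnSet R M) :
    sInf T ∈ AnnSet R M := by
  refine ⟨{f | ∃ N ∈ T, N ≤ LinearMap.ker f}, ?_⟩
  ext m
  simp only [Submodule.mem_sInf, Submodule.mem_iInf, LinearMap.mem_ker, Set.mem_ofPred_eq]
  constructor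
  · rintro h f ⟨N, hN, hf⟩
    exact hf (h N hN)
  · intro h N hN
    obtain ⟨X, rfl⟩ := hT hN
    simp only [Submodule.mem_iInf, LinearMap.mem_ker]
    exact fun f hf => h f ⟨_, hN, iInf₂_le f hf⟩

theorem ker_mem_annSet (f : M →ₗ[R] M) : LinearMap.ker f ∈ AnnSet R M :=
  ⟨{f}, by simp⟩

theorem AccOnAnnihilators.exists_maximal (hacc : AccOnAnnihilators R M)
    {T : Set (Submodule R M)} (hT : T ⊆ AnnSet R M) (hne : T.Nonempty) :
    ∃ m ∈ T, ∀ x ∈ T, m ≤ x → x = m := by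
  have hwf : WellFoundedGT (AnnSet R M) := by
    rw [wellFoundedGT_iff_monotone_chain_condition]
    intro a
    obtain ⟨n, hn⟩ := hacc (fun k => a k) (fun k => (a k).2) (fun i j h => a.monotone h)
    exact ⟨n, fun m hm => Subtype.ext (hn m hm).symm⟩
  obtain ⟨x, hx⟩ := hne
  obtain ⟨m, hm, hmax⟩ := hwf.wf.has_min {y : AnnSet R M | (y : Submodule R M) ∈ T}
    ⟨⟨x, hT hx⟩, hx⟩
  refine ⟨m, hm, fun y hy hle => ?_⟩
  by_contra hne
  exact hmax ⟨y, hT hy⟩ hy (lt_of_le_of_ne hle fun h => hne (congrArg Subtype.val h).symm)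

theorem prodM_eq_bot_iff {K L : Submodule R M} : prodM R M K L = ⊥ ↔ K ≤ annM R M L := by
  rw [prodM, eq_bot_iff, iSup₂_le_iff]
  constructor
  · intro h k hk
    refine mem_annM.2 fun f => Subtype.ext (h (L.subtype ∘ₗ f) ?_ ⟨k, hk, rfl⟩)
    rintro _ ⟨x, rfl⟩
    exact (f x).2
  · rintro h f hf _ ⟨k, hk, rfl⟩
    exact congrArg Subtype.val (mem_annM.1 (h hk) (f.codRestrict L fun x => hf ⟨x, rfl⟩))

theorem map_le_prodM (K : Submodule R M) {L : Submodule R M} (f : M →ₗ[R] L) :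
    K.map (L.subtype ∘ₗ f) ≤ prodM R M K L := by
  refine le_iSup₂_of_le (L.subtype ∘ₗ f) ?_ le_rfl
  rintro _ ⟨x, rfl⟩
  exact (f x).2

theorem prodM_le_inf {K L : Submodule R M} (hK : IsFullyInvariant R M K) :
    prodM R M K L ≤ K ⊓ L :=
  iSup₂_le fun f hf => le_inf (hK f) (LinearMap.map_le_range.trans hf)

theorem IsSemiprime.not_le_annM (hsemi : IsSemiprime R M) {L : Submodule R M} (hL : L ≠ ⊥) :
    ¬ L ≤ annM R M L := fun h => hL (hsemi L (prodM_eq_bot_iff.2 h))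

theorem IsSemiprime.exists_hom_ne_zero (hsemi : IsSemiprime R M) {L : Submodule R M}
    (hL : L ≠ ⊥) : ∃ f : M →ₗ[R] L, ∃ x ∈ L, f x ≠ 0 := by
  obtain ⟨x, hx, h⟩ := SetLike.not_le_iff_exists.1 (hsemi.not_le_annM hL)
  rw [mem_annM] at h
  push Not at h
  obtain ⟨f, hf⟩ := h
  exact ⟨f, x, hx, hf⟩

end Annihilator

section Nonsingular

variable {R : Type u} [Ring R] {M : Type v} [AddCommGroup M] [Module R M]

/-- `N` meets every nonzero submodule. -/
def IsEssentialSub {X : Type v} [AddCommGroup X] [Module R X] (N : Submodule R X) : Prop :=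
  ∀ K : Submodule R X, Disjoint N K → K = ⊥

theorem IsEssentialSub.mono {X : Type v} [AddCommGroup X] [Module R X] {N N' : Submodule R X}
    (h : IsEssentialSub N) (hle : N ≤ N') : IsEssentialSub N' :=
  fun K hK => h K (hK.mono_left hle)

theorem IsEssentialSub.comap {X Y : Type v} [AddCommGroup X] [Module R X] [AddCommGroup Y]
    [Module R Y] {N : Submodule R Y} (h : IsEssentialSub N) (f : X →ₗ[R] Y) :
    IsEssentialSub (N.comap f) := by
  intro K hK
  have h1 : K.map f = ⊥ := by
    refine h _ (Submodule.disjoint_def.2 ?_)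
    rintro _ hy ⟨x, hx, rfl⟩
    rw [Submodule.disjoint_def.1 hK x hy hx, map_zero]
  refine hK.eq_bot_of_ge fun x hx => ?_
  have : f x ∈ K.map f := ⟨x, hx, rfl⟩
  rw [h1, Submodule.mem_bot] at this
  rw [Submodule.mem_comap, this]
  exact zero_mem _

theorem end_eq_zero_of_isEssentialSub_ker (hproj : ProjInSigma R M) (hsemi : IsSemiprime R M)
    (hacc : AccOnAnnihilators R M) (g : M →ₗ[R] M) (hg : IsEssentialSub (LinearMap.ker g)) :
    g = 0 := by
  by_contra hne
  obtain ⟨_, ⟨g, ⟨hg, hne⟩, rfl⟩, hmax⟩ := hacc.exists_maximal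
    (T := LinearMap.ker '' {g : M →ₗ[R] M | IsEssentialSub (LinearMap.ker g) ∧ g ≠ 0})
    (by rintro _ ⟨f, -, rfl⟩; exact ker_mem_annSet f) ⟨_, g, ⟨hg, hne⟩, rfl⟩
  have key : ∀ s : M →ₗ[R] M, g ∘ₗ s ∘ₗ g = 0 := by
    intro s
    by_contra hs
    have hle : LinearMap.ker g ≤ LinearMap.ker (g ∘ₗ s ∘ₗ g) := LinearMap.ker_le_ker_comp g (g ∘ₗ s)
    have heq := hmax _ ⟨_, ⟨hg.mono hle, hs⟩, rfl⟩ hle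
    have hbot : LinearMap.range (s ∘ₗ g) = ⊥ := by
      refine hg _ (Submodule.disjoint_def.2 ?_)
      rintro _ hx ⟨m, rfl⟩
      have : m ∈ LinearMap.ker g := by
        rw [← heq]
        exact hx
      rw [LinearMap.comp_apply, LinearMap.mem_ker.1 this, map_zero]
    rw [LinearMap.range_eq_bot] at hbot
    exact hs (by rw [hbot, LinearMap.comp_zero])
  refine hne (LinearMap.range_eq_bot.1 (hsemi _ (prodM_eq_bot_iff.2 ?_)))
  rintro _ ⟨m, rfl⟩
  refine mem_annM.2 fun f => ?_
  obtain ⟨s, rfl⟩ := hproj M (LinearMap.range g) (inSigma_self R M)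
    ((inSigma_self R M).submodule _) g.rangeRestrict g.surjective_rangeRestrict f
  exact Subtype.ext (LinearMap.congr_fun (key s) m)

theorem eq_zero_of_isEssentialSub_ker (hproj : ProjInSigma R M) (hsemi : IsSemiprime R M)
    (hacc : AccOnAnnihilators R M) {X : Type v} [AddCommGroup X] [Module R X]
    (hX : InSigma R M X) (f : X →ₗ[R] M) (hf : IsEssentialSub (LinearMap.ker f)) : f = 0 := by
  by_contra hne
  obtain ⟨g, x, hx, hgx⟩ := hsemi.exists_hom_ne_zero
    (L := LinearMap.range f) (by rwa [Ne, LinearMap.range_eq_bot])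
  obtain ⟨h, rfl⟩ := hproj X (LinearMap.range f) hX
    ((inSigma_self R M).submodule _) f.rangeRestrict f.surjective_rangeRestrict g
  have h0 := end_eq_zero_of_isEssentialSub_ker hproj hsemi hacc (f ∘ₗ h) (hf.comap h)
  exact hgx (Subtype.ext (LinearMap.congr_fun h0 x))

/-- Any two nonzero submodules of `X` intersect nontrivially. -/
def IsUniformModule (R : Type u) [Ring R] (X : Type v) [AddCommGroup X] [Module R X] : Prop :=
  ∀ N : Submodule R X, N ≠ ⊥ → IsEssentialSub N

theorem Submodule.map_ne_bot_of_injective {X Y : Type v} [AddCommGroup X] [Module R X]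
    [AddCommGroup Y] [Module R Y] {i : X →ₗ[R] Y} (hi : Function.Injective i)
    {N : Submodule R X} (hN : N ≠ ⊥) : N.map i ≠ ⊥ := fun h =>
  hN (Submodule.map_injective_of_injective hi (by rw [h, Submodule.map_bot]))

theorem IsUniformModule.of_injective {X Y : Type v} [AddCommGroup X] [Module R X]
    [AddCommGroup Y] [Module R Y] (h : IsUniformModule R Y) (i : X →ₗ[R] Y)
    (hi : Function.Injective i) : IsUniformModule R X := by
  intro N hN A hNA
  by_contra hA
  exact Submodule.map_ne_bot_of_injective hi hA
    (h _ (Submodule.map_ne_bot_of_injective hi hN) _ (Submodule.disjoint_map hi hNA))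

theorem IsUniformModule.injective_of_ne_zero (hproj : ProjInSigma R M) (hsemi : IsSemiprime R M)
    (hacc : AccOnAnnihilators R M) {X : Type v} [AddCommGroup X] [Module R X]
    (hX : InSigma R M X) (hu : IsUniformModule R X) {f : X →ₗ[R] M} (hf : f ≠ 0) :
    Function.Injective f := by
  rw [← LinearMap.ker_eq_bot]
  by_contra hk
  exact hf (eq_zero_of_isEssentialSub_ker hproj hsemi hacc hX f (hu _ hk))

end Nonsingular

section AnnStable

variable {R : Type u} [Ring R] {M : Type v} [AddCommGroup M] [Module R M]

/-- `L` is nonzero and all its nonzero submodules have the same annihilator in `M`. -/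
def IsAnnStable (L : Submodule R M) : Prop :=
  L ≠ ⊥ ∧ ∀ L' ≤ L, L' ≠ ⊥ → annM R M L' = annM R M L

theorem IsAnnStable.of_le {L L' : Submodule R M} (h : IsAnnStable L) (hle : L' ≤ L)
    (hne : L' ≠ ⊥) : IsAnnStable L' :=
  ⟨hne, fun K hK hK0 => by rw [h.2 K (hK.trans hle) hK0, h.2 L' hle hne]⟩

theorem exists_isAnnStable_le (hacc : AccOnAnnihilators R M) {N : Submodule R M} (hN : N ≠ ⊥) :
    ∃ L ≤ N, IsAnnStable L := by
  obtain ⟨_, ⟨L, ⟨hLN, hL⟩, rfl⟩, hmax⟩ := hacc.exists_maximal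
    (T := (fun L : Submodule R M => annM R M L) '' {L | L ≤ N ∧ L ≠ ⊥})
    (by rintro _ ⟨L, -, rfl⟩; exact annM_submodule_mem_annSet L) ⟨_, N, ⟨le_rfl, hN⟩, rfl⟩
  exact ⟨L, hLN, hL, fun L' hle hne => hmax _ ⟨L', ⟨hle.trans hLN, hne⟩, rfl⟩
    (annM_le_of_injective (Submodule.inclusion hle) (Submodule.inclusion_injective hle))⟩

theorem IsAnnStable.primeIn (hproj : ProjInSigma R M) (hsemi : IsSemiprime R M)
    {L : Submodule R M} (hL : IsAnnStable L) : PrimeIn R M (annM R M L) := by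
  refine ⟨fun h => hsemi.not_le_annM hL.1 (h ▸ le_top), isFullyInvariant_annM _,
    fun K N _ _ hKN => or_iff_not_imp_right.2 fun hN => ?_⟩
  obtain ⟨x, hx, h⟩ := SetLike.not_le_iff_exists.1 hN
  rw [mem_annM] at h
  push Not at h
  obtain ⟨f, hf⟩ := h
  let f' : N →ₗ[R] M := L.subtype ∘ₗ f ∘ₗ N.subtype
  have hle : LinearMap.range f' ≤ L := by
    rintro _ ⟨y, rfl⟩
    exact (f y).2
  have hne : LinearMap.range f' ≠ ⊥ := by
    intro h0
    rw [LinearMap.range_eq_bot] at h0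
    exact hf (Subtype.ext (LinearMap.congr_fun h0 ⟨x, hx⟩))
  rw [← hL.2 _ hle hne]
  intro k hk
  refine mem_annM.2 fun h => ?_
  obtain ⟨g, rfl⟩ := hproj N (LinearMap.range f') ((inSigma_self R M).submodule _)
    ((inSigma_self R M).submodule _) f'.rangeRestrict f'.surjective_rangeRestrict h
  have hgk : (g k : M) ∈ annM R M L := hKN (map_le_prodM K g ⟨k, hk, rfl⟩)
  refine Subtype.ext ?_
  have h0 : f (g k) = 0 := mem_annM.1 hgk f
  have h1 : (f (g k) : M) = 0 := by rw [h0, ZeroMemClass.coe_zero]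
  exact h1

/-- A prime in `M` contains a submodule or its annihilator. -/
theorem PrimeIn.annM_le_or_le (hproj : ProjInSigma R M) {Q : Submodule R M}
    (hQ : PrimeIn R M Q) (L : Submodule R M) : annM R M L ≤ Q ∨ L ≤ Q := by
  let π : ((M →ₗ[R] M) →₀ L) →ₗ[R] M := Finsupp.lsum ℕ fun s : M →ₗ[R] M => s ∘ₗ L.subtype
  have hsingle : ∀ (s : M →ₗ[R] M) (l : L), π (Finsupp.single s l) = s l := fun s l => by
    simp [π]
  have hLπ : L ≤ LinearMap.range π := fun l hl =>
    ⟨Finsupp.single LinearMap.id ⟨l, hl⟩, hsingle _ _⟩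
  have hinv : IsFullyInvariant R M (LinearMap.range π) := by
    rintro t _ ⟨_, ⟨x, rfl⟩, rfl⟩
    induction x using Finsupp.induction_linear with
    | zero => simp
    | add a b ha hb =>
      rw [map_add, map_add]
      exact add_mem ha hb
    | single s l => exact ⟨Finsupp.single (t ∘ₗ s) l, by rw [hsingle, hsingle]; rfl⟩
  have hprod : prodM R M (annM R M L) (LinearMap.range π) = ⊥ := by
    refine prodM_eq_bot_iff.2 fun m hm => mem_annM.2 fun f => ?_
    obtain ⟨g, rfl⟩ := hproj _ (LinearMap.range π) (inSigma_finsupp_submodule _ L)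
      ((inSigma_self R M).submodule _) π.rangeRestrict π.surjective_rangeRestrict f
    have : g m = 0 := Finsupp.ext fun s => mem_annM.1 hm (Finsupp.lapply s ∘ₗ g)
    rw [LinearMap.comp_apply, this, map_zero]
  exact (hQ.2.2 _ _ (isFullyInvariant_annM _) hinv (hprod ▸ bot_le)).imp_right hLπ.trans

theorem IsAnnStable.minPrimeIn (hproj : ProjInSigma R M) (hsemi : IsSemiprime R M)
    {L : Submodule R M} (hL : IsAnnStable L) : MinPrimeIn R M (annM R M L) :=
  ⟨hL.primeIn hproj hsemi, fun _ hQ hle => le_antisymm hle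
    ((hQ.annM_le_or_le hproj L).resolve_right fun h => hsemi.not_le_annM hL.1 (h.trans hle))⟩

theorem PrimeIn.exists_le_of_sInf_le {P : Submodule R M} (hP : PrimeIn R M P)
    {T : Set (Submodule R M)} (hfin : T.Finite) (hT : ∀ N ∈ T, IsFullyInvariant R M N)
    (h : sInf T ≤ P) : ∃ N ∈ T, N ≤ P := by
  have hInf : ∀ T : Set (Submodule R M), (∀ N ∈ T, IsFullyInvariant R M N) →
      IsFullyInvariant R M (sInf T) := fun T hT f =>
    le_sInf fun N hN => (Submodule.map_mono (sInf_le hN)).trans (hT N hN f)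
  induction T, hfin using Set.Finite.induction_on with
  | empty =>
    rw [sInf_empty, top_le_iff] at h
    exact absurd h hP.1
  | @insert a s _ _ ih =>
    rw [sInf_insert] at h
    have ha := hT a (Set.mem_insert _ _)
    have hs : ∀ N ∈ s, IsFullyInvariant R M N := fun N hN => hT N (Set.mem_insert_of_mem _ hN)
    rcases hP.2.2 _ _ ha (hInf s hs) ((prodM_le_inf ha).trans h) with h1 | h1
    · exact ⟨a, Set.mem_insert _ _, h1⟩
    · obtain ⟨N, hN, hNP⟩ := ih hs h1
      exact ⟨N, Set.mem_insert_of_mem _ hN, hNP⟩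

theorem finite_annM_isAnnStable (hproj : ProjInSigma R M) (hsemi : IsSemiprime R M)
    (hacc : AccOnAnnihilators R M) :
    {P | ∃ L : Submodule R M, IsAnnStable L ∧ annM R M L = P}.Finite := by
  set T := {P | ∃ L : Submodule R M, IsAnnStable L ∧ annM R M L = P}
  have hT : T ⊆ AnnSet R M := by
    rintro _ ⟨L, -, rfl⟩
    exact annM_submodule_mem_annSet L
  obtain ⟨_, ⟨F, hF, rfl⟩, hmax⟩ := hacc.exists_maximal
    (T := (fun F : Set (Submodule R M) => sInf (T \ F)) '' {F | F.Finite})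
    (by rintro _ ⟨F, -, rfl⟩; exact sInf_mem_annSet (Set.sdiff_subset.trans hT))
    ⟨_, ∅, Set.finite_empty, rfl⟩
  refine hF.subset fun P hP => ?_
  by_contra hPF
  have heq := hmax _ ⟨insert P F, hF.insert P, rfl⟩
    (sInf_le_sInf (Set.sdiff_subset_sdiff_right (Set.subset_insert P F)))
  obtain ⟨L, hL, rfl⟩ := hP
  have h1 : L ≤ sInf (T \ insert (annM R M L) F) := by
    refine le_sInf ?_
    rintro Q ⟨⟨K, hK, rfl⟩, hQ⟩
    have hK' := hK.minPrimeIn hproj hsemi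
    refine (hK'.1.annM_le_or_le hproj L).resolve_left fun h => hQ ?_
    exact Set.mem_insert_iff.2 (Or.inl (hK'.2 _ (hL.primeIn hproj hsemi) h).symm)
  refine hsemi.not_le_annM hL.1 (h1.trans ?_)
  refine heq.le.trans ?_
  exact sInf_le ⟨⟨L, hL, rfl⟩, hPF⟩

theorem MinPrimeIn.exists_isAnnStable (hproj : ProjInSigma R M) (hsemi : IsSemiprime R M)
    (hacc : AccOnAnnihilators R M) {P : Submodule R M} (hP : MinPrimeIn R M P) :
    ∃ L : Submodule R M, IsAnnStable L ∧ annM R M L = P := by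
  obtain ⟨_, ⟨L, hL, rfl⟩, hle⟩ := hP.1.exists_le_of_sInf_le
    (finite_annM_isAnnStable hproj hsemi hacc)
    (by rintro _ ⟨L, -, rfl⟩; exact isFullyInvariant_annM _) (by
      have : sInf {P | ∃ L : Submodule R M, IsAnnStable L ∧ annM R M L = P} = ⊥ := by
        by_contra hne
        obtain ⟨L, hle, hL⟩ := exists_isAnnStable_le hacc hne
        exact hsemi.not_le_annM hL.1 (hle.trans (sInf_le ⟨L, hL, rfl⟩))
      rw [this]
      exact bot_le)
  exact ⟨L, hL, hP.2 _ (hL.primeIn hproj hsemi) hle⟩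

end AnnStable

section Bijection

variable {R : Type u} [Ring R] {M : Type v} [AddCommGroup M] [Module R M]

theorem InjInSigma.isUniformModule {E : Type v} [AddCommGroup E] [Module R E]
    (hE : InjInSigma R M E) (hind : Indecomp R E) : IsUniformModule R E := by
  intro N hN X hNX
  obtain ⟨A, B, hAB, hNA, hess⟩ := hE.exists_isCompl_essential N
  rcases hind.2 A B hAB with rfl | rfl
  · exact absurd (le_bot_iff.1 hNA) hN
  · exact hess X le_top hNX

theorem IsUniformModule.indecomp {E : Type v} [AddCommGroup E] [Module R E]
    (h : IsUniformModule R E) (hne : (⊥ : Submodule R E) ≠ ⊤) : Indecomp R E := by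
  refine ⟨hne, fun A B hAB => or_iff_not_imp_left.2 fun hA => ?_⟩
  have hB := h A hA B hAB.disjoint
  subst hB
  exact hAB.sup_eq_top.symm ▸ (sup_bot_eq A).symm

theorem exists_isAnnStable_embedding (hproj : ProjInSigma R M) (hsemi : IsSemiprime R M)
    (hacc : AccOnAnnihilators R M) {E : Type v} [AddCommGroup E] [Module R E]
    (hE : InjInSigma R M E) (hind : Indecomp R E) (htf : ChiTorsionFree R M E) :
    ∃ L : Submodule R M, IsAnnStable L ∧ ∃ i : L →ₗ[R] E, Function.Injective i := by
  obtain ⟨K, f, hf⟩ := htf.exists_hom_ne_zero hind.1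
  have hinj : Function.Injective f :=
    IsUniformModule.injective_of_ne_zero hproj hsemi hacc (hE.1.submodule K)
      ((hE.isUniformModule hind).of_injective K.subtype K.injective_subtype) hf
  obtain ⟨L, hle, hL⟩ := exists_isAnnStable_le hacc
    (N := LinearMap.range f) (by rwa [Ne, LinearMap.range_eq_bot])
  exact ⟨L, hL, K.subtype ∘ₗ (LinearEquiv.ofInjective f hinj).symm.toLinearMap ∘ₗ
    Submodule.inclusion hle, K.injective_subtype.comp
      ((LinearEquiv.ofInjective f hinj).symm.injective.comp (Submodule.inclusion_injective hle))⟩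

theorem IsAnnStable.annM_eq_of_embedding {E : Type v} [AddCommGroup E] [Module R E]
    {L : Submodule R M} (hL : IsAnnStable L) {i : L →ₗ[R] E} (hi : Function.Injective i)
    {N : Submodule R E} (hN : N ≠ ⊥) (hle : N ≤ LinearMap.range i) :
    annM R M N = annM R M L := by
  have hmap : (N.comap i).map i = N := Submodule.map_comap_eq_of_le hle
  have hne : (N.comap i).map L.subtype ≠ ⊥ := by
    refine Submodule.map_ne_bot_of_injective L.injective_subtype fun h => hN ?_
    rw [← hmap, h, Submodule.map_bot]
  rw [← hL.2 _ (Submodule.map_subtype_le L _) hne]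
  refine annM_congr ((LinearEquiv.ofEq _ _ hmap.symm).trans
    ((Submodule.equivMapOfInjective i hi _).symm.trans
      (Submodule.equivMapOfInjective L.subtype L.injective_subtype _)))

theorem IsAnnStable.assM_eq (hsemi : IsSemiprime R M) {E : Type v} [AddCommGroup E] [Module R E]
    (hu : IsUniformModule R E) {L : Submodule R M} (hL : IsAnnStable L) {i : L →ₗ[R] E}
    (hi : Function.Injective i) : AssM R M E = {annM R M L} := by
  have hne : LinearMap.range i ≠ ⊥ := by
    rw [← Submodule.map_top]
    refine Submodule.map_ne_bot_of_injective hi fun h => hL.1 ?_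
    exact Submodule.subsingleton_iff_eq_bot.1 ((Submodule.subsingleton_iff R).1
      (subsingleton_of_bot_eq_top h.symm))
  ext Q
  constructor
  · rintro ⟨-, -, N, hN, hann⟩
    have hinf : N ⊓ LinearMap.range i ≠ ⊥ := fun h => hne (hu N hN _ (disjoint_iff.2 h))
    exact (hann _ hinf inf_le_left).symm.trans (hL.annM_eq_of_embedding hi hinf inf_le_right)
  · rintro rfl
    exact ⟨fun h => hsemi.not_le_annM hL.1 (h ▸ le_top), isFullyInvariant_annM _, _, hne,
      fun N hN hle => hL.annM_eq_of_embedding hi hN hle⟩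

/-- An injective object of `σ[M]` is a direct summand of any module in `σ[M]` into which it
embeds, hence isomorphic to it when the latter is indecomposable. -/
theorem InjInSigma.nonempty_linearEquiv_of_injective {E E' : Type v} [AddCommGroup E]
    [Module R E] [AddCommGroup E'] [Module R E'] (hE : InjInSigma R M E)
    (hind : Indecomp R E) (hE' : InSigma R M E') (hind' : Indecomp R E') (g : E →ₗ[R] E')
    (hg : Function.Injective g) : Nonempty (E ≃ₗ[R] E') := by
  obtain ⟨h, hh⟩ := hE.2 E' hE' (LinearMap.range g) (LinearEquiv.ofInjective g hg).symm.toLinearMap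
  have hhg : ∀ x, h (g x) = x := fun x => by
    have := hh (LinearEquiv.ofInjective g hg x)
    rwa [LinearEquiv.coe_coe, LinearEquiv.symm_apply_apply] at this
  have hcompl : IsCompl (LinearMap.range g) (LinearMap.ker h) := by
    refine ⟨Submodule.disjoint_def.2 ?_, codisjoint_iff.2 (eq_top_iff.2 fun y _ => ?_)⟩
    · rintro _ ⟨x, rfl⟩ hx
      rw [LinearMap.mem_ker, hhg] at hx
      rw [hx, map_zero]
    · refine Submodule.mem_sup.2 ⟨g (h y), ⟨h y, rfl⟩, y - g (h y), ?_, by abel⟩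
      rw [LinearMap.mem_ker, map_sub, hhg, sub_self]
  refine ⟨LinearEquiv.ofBijective g ⟨hg, LinearMap.range_eq_top.1 ?_⟩⟩
  refine (hind'.2 _ _ hcompl).resolve_left fun h0 => hind.1 ?_
  rw [LinearMap.range_eq_bot] at h0
  subst h0
  exact (Submodule.eq_bot_iff _).2 (fun x _ => @hg x 0 rfl) |>.symm

theorem nonempty_linearEquiv_of_annM_eq (hproj : ProjInSigma R M) (hsemi : IsSemiprime R M)
    (hacc : AccOnAnnihilators R M) {E E' : Type v} [AddCommGroup E] [Module R E]
    [AddCommGroup E'] [Module R E'] (hE : InjInSigma R M E) (hind : Indecomp R E)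
    (hE' : InjInSigma R M E') (hind' : Indecomp R E') {L L' : Submodule R M} (hL : L ≠ ⊥)
    {i : L →ₗ[R] E} (hi : Function.Injective i) {i' : L' →ₗ[R] E'}
    (hi' : Function.Injective i') (h : annM R M L = annM R M L') : Nonempty (E ≃ₗ[R] E') := by
  have hu := hE.isUniformModule hind
  obtain ⟨x, hx, hxL⟩ := SetLike.not_le_iff_exists.1 (h ▸ hsemi.not_le_annM hL)
  rw [mem_annM] at hxL
  push Not at hxL
  obtain ⟨f, hf⟩ := hxL
  have hinj : Function.Injective (L'.subtype ∘ₗ f ∘ₗ L.subtype) :=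
    IsUniformModule.injective_of_ne_zero hproj hsemi hacc ((inSigma_self R M).submodule L)
      (hu.of_injective i hi)
      fun h0 => hf (Subtype.ext (LinearMap.congr_fun h0 ⟨x, hx⟩))
  have hfL : Function.Injective (f ∘ₗ L.subtype) := fun a b hab => hinj (congrArg Subtype.val hab)
  obtain ⟨g, hg⟩ := hE'.2 E hE.1 (LinearMap.range i)
    (i' ∘ₗ (f ∘ₗ L.subtype) ∘ₗ (LinearEquiv.ofInjective i hi).symm.toLinearMap)
  refine hE.nonempty_linearEquiv_of_injective hind hE'.1 hind' g ?_
  rw [← LinearMap.ker_eq_bot]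
  refine hu (LinearMap.range i) ?_ _ ?_
  · intro h0
    rw [LinearMap.range_eq_bot] at h0
    subst h0
    exact hL (eq_bot_iff.2 fun y hy => congrArg Subtype.val (@hi ⟨y, hy⟩ 0 rfl))
  · rw [Submodule.disjoint_def]
    rintro y hy hgy
    have h1 := hg ⟨y, hy⟩
    rw [LinearMap.mem_ker] at hgy
    rw [hgy] at h1
    have h2 : (⟨y, hy⟩ : LinearMap.range i) = 0 :=
      (hi'.comp (hfL.comp (LinearEquiv.injective (LinearEquiv.ofInjective i hi).symm)))
        (h1.symm.trans (map_zero (i' ∘ₗ (f ∘ₗ L.subtype) ∘ₗ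
          (LinearEquiv.ofInjective i hi).symm.toLinearMap)).symm)
    exact congrArg Subtype.val h2

theorem UniformSub.isUniformModule {U : Submodule R M} (h : UniformSub R M U) :
    IsUniformModule R U := by
  intro N hN A hNA
  by_contra hA
  exact h.2 _ _ (Submodule.map_subtype_le U N) (Submodule.map_subtype_le U A)
    (Submodule.map_ne_bot_of_injective U.injective_subtype hN)
    (Submodule.map_ne_bot_of_injective U.injective_subtype hA)
    (disjoint_iff.1 (Submodule.disjoint_map U.injective_subtype hNA))

theorem IsEssentialSub.eq_bot_of_comap_eq_bot {X E : Type v} [AddCommGroup X] [Module R X]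
    [AddCommGroup E] [Module R E] {i : X →ₗ[R] E} (hess : IsEssentialSub (LinearMap.range i))
    {N : Submodule R E} (h : N.comap i = ⊥) : N = ⊥ := by
  refine hess N (Submodule.disjoint_def.2 ?_)
  rintro _ ⟨x, rfl⟩ hx
  have : x ∈ N.comap i := hx
  rw [h, Submodule.mem_bot] at this
  rw [this, map_zero]

theorem IsUniformModule.of_isEssentialSub_range {X E : Type v} [AddCommGroup X] [Module R X]
    [AddCommGroup E] [Module R E] (h : IsUniformModule R X) {i : X →ₗ[R] E}
    (hi : Function.Injective i) (hess : IsEssentialSub (LinearMap.range i)) :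
    IsUniformModule R E := by
  intro N hN A hNA
  refine hess.eq_bot_of_comap_eq_bot (h (N.comap i)
    (fun h0 => hN (hess.eq_bot_of_comap_eq_bot h0)) _ (Submodule.disjoint_def.2 ?_))
  intro x hxN hxA
  exact hi ((Submodule.disjoint_def.1 hNA _ hxN hxA).trans (map_zero i).symm)

theorem ChiTorsion.of_injective {N N' : Type v} [AddCommGroup N] [Module R N]
    [AddCommGroup N'] [Module R N'] (h : ChiTorsion R M N') (f : N →ₗ[R] N')
    (hf : Function.Injective f) : ChiTorsion R M N := by
  obtain ⟨τ, hM, hτ⟩ := h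
  exact ⟨τ, hM, τ.closed_iso _ _ (LinearEquiv.ofInjective f hf).symm (τ.closed_sub _ hτ _)⟩

theorem chiTorsionFree_of_isEssentialSub_range {E : Type v} [AddCommGroup E] [Module R E]
    {L : Submodule R M} {i : L →ₗ[R] E} (hi : Function.Injective i)
    (hess : IsEssentialSub (LinearMap.range i)) : ChiTorsionFree R M E := by
  intro K hK
  refine hess.eq_bot_of_comap_eq_bot ((Submodule.eq_bot_iff _).2 fun x hx => Subtype.ext ?_)
  have hN : ChiTorsion R M (K.comap i) := hK.of_injective (i.restrict fun x hx => hx)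
    fun a b hab => Subtype.ext (hi (congrArg Subtype.val hab))
  exact LinearMap.congr_fun (hN.hom_eq_zero (L.subtype ∘ₗ (K.comap i).subtype)) ⟨x, hx⟩

end Bijection

/-- Theorem 2.7: bijection between isomorphism classes of
indecomposable `χ(M)`-torsion-free injectives in `σ[M]` and minimal primes in
`M`, via `E ↦ P` where `Ass_M(E) = {P}`. -/
theorem stmt_13 (R : Type u) [Ring R] (M : Type v) [AddCommGroup M] [Module R M]
    (hproj : ProjInSigma R M) (hsemi : IsSemiprime R M)
    (hacc : AccOnAnnihilators R M)
    (hunif : ∀ N : Submodule R M, N ≠ ⊥ → ∃ U : Submodule R M,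
      U ≤ N ∧ UniformSub R M U) :
    -- the map is well defined into the minimal primes
    (∀ (E : Type v) [AddCommGroup E] [Module R E],
      InjInSigma R M E → Indecomp R E → ChiTorsionFree R M E →
        ∃ P : Submodule R M, MinPrimeIn R M P ∧ AssM R M E = {P}) ∧
    -- injectivity: equal associated primes force isomorphism
    (∀ (E : Type v) [AddCommGroup E] [Module R E]
        (E' : Type v) [AddCommGroup E'] [Module R E'],
      InjInSigma R M E → Indecomp R E → ChiTorsionFree R M E →
      InjInSigma R M E' → Indecomp R E' → ChiTorsionFree R M E' →
      AssM R M E = AssM R M E' → Nonempty (E ≃ₗ[R] E')) ∧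
    -- surjectivity: every minimal prime is attained
    (∀ P : Submodule R M, MinPrimeIn R M P →
      ∃ (E : Type v) (iE : AddCommGroup E)
        (mE : @Module R E inferInstance iE.toAddCommMonoid),
        letI := iE
        letI := mE
        InjInSigma R M E ∧ Indecomp R E ∧ ChiTorsionFree R M E ∧
          AssM R M E = {P}) := by
  refine ⟨?_, ?_, ?_⟩
  · intro E _ _ hE hind htf
    obtain ⟨L, hL, i, hi⟩ := exists_isAnnStable_embedding hproj hsemi hacc hE hind htf
    exact ⟨_, hL.minPrimeIn hproj hsemi, hL.assM_eq hsemi (hE.isUniformModule hind) hi⟩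
  · intro E _ _ E' _ _ hE hind htf hE' hind' htf' hAss
    obtain ⟨L, hL, i, hi⟩ := exists_isAnnStable_embedding hproj hsemi hacc hE hind htf
    obtain ⟨L', hL', i', hi'⟩ := exists_isAnnStable_embedding hproj hsemi hacc hE' hind' htf'
    rw [hL.assM_eq hsemi (hE.isUniformModule hind) hi,
      hL'.assM_eq hsemi (hE'.isUniformModule hind') hi', Set.singleton_eq_singleton_iff] at hAss
    exact nonempty_linearEquiv_of_annM_eq hproj hsemi hacc hE hind hE' hind' hL.1 hi hi' hAss
  · intro P hP
    obtain ⟨L, hL, rfl⟩ := hP.exists_isAnnStable hproj hsemi hacc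
    obtain ⟨U, hUL, hU⟩ := hunif L hL.1
    obtain ⟨E, _, _, hE, i, hi, hess⟩ := exists_injective_hull U
    have hu : IsUniformModule R E := hU.isUniformModule.of_isEssentialSub_range hi hess
    have hUs : IsAnnStable U := hL.of_le hUL hU.1
    refine ⟨E, inferInstance, inferInstance, hE, hu.indecomp fun h => hU.1 ?_,
      chiTorsionFree_of_isEssentialSub_range hi hess, ?_⟩
    · refine (Submodule.eq_bot_iff _).2 fun x hx => ?_
      have : i ⟨x, hx⟩ ∈ (⊥ : Submodule R E) := h ▸ trivial
      exact congrArg Subtype.val (hi (((Submodule.mem_bot R).1 this).trans (map_zero i).symm))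
    · rw [← hL.2 U hUL hU.1]
      exact hUs.assM_eq hsemi hu hi
end

section
/- Let M be an R-module projective in σ[M], semiprime, satisfying ACC on annihilators, with minimal primes in M being P_1, ..., P_n. Then the family { N_1, ..., N_n } with N_i = Ann_M^r(P_i) is an independent family (their sum is direct). -/
/- Common definitions: the category σ[M], projectivity in σ[M], the product
   K_M L of submodules, annihilators, prime/semiprime submodules, hereditary
   torsion theories, M-singular modules, etc., following the paper. -/

universe u v

theorem prodM_eq_bot_iff_s15 {R : Type u} [Ring R] {M : Type v} [AddCommGroup M] [Module R M]
    {K L : Submodule R M} :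
    prodM R M K L = ⊥ ↔ ∀ f : M →ₗ[R] M, LinearMap.range f ≤ L → ∀ x ∈ K, f x = 0 := by
  simp [prodM, Submodule.eq_bot_iff]

theorem inSigma_submodule_finsupp {R : Type u} [Ring R] {M : Type v} [AddCommGroup M]
    [Module R M] {ι : Type v} (A : Submodule R (ι →₀ M)) : InSigma R M A := by
  refine ⟨ι, ⊥, (Submodule.mkQ ⊥).comp A.subtype, ?_⟩
  rw [← LinearMap.ker_eq_bot, LinearMap.ker_comp, Submodule.ker_mkQ, Submodule.comap_bot,
    Submodule.ker_subtype]

theorem inSigma_submodule {R : Type u} [Ring R] {M : Type v} [AddCommGroup M]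
    [Module R M] (L : Submodule R M) : InSigma R M L := by
  refine ⟨PUnit, ⊥, (Submodule.mkQ ⊥).comp ((Finsupp.lsingle PUnit.unit).comp L.subtype), ?_⟩
  rw [← LinearMap.ker_eq_bot, LinearMap.ker_comp, Submodule.ker_mkQ, Submodule.comap_bot,
    LinearMap.ker_eq_bot]
  exact (Finsupp.single_injective PUnit.unit).comp L.subtype_injective

/-- Endomorphisms of a module `M` projective in `σ[M]` lift along maps from objects of `σ[M]`
whose range contains theirs. -/
theorem ProjInSigma.exists_lift {R : Type u} [Ring R] {M : Type v} [AddCommGroup M]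
    [Module R M] (hproj : ProjInSigma R M) {A : Type v} [AddCommGroup A] [Module R A]
    (hA : InSigma R M A) (q : A →ₗ[R] M) (f : M →ₗ[R] M)
    (hf : LinearMap.range f ≤ LinearMap.range q) : ∃ g : M →ₗ[R] A, q.comp g = f := by
  obtain ⟨g, hg⟩ := hproj A (LinearMap.range q) hA (inSigma_submodule _) q.rangeRestrict
    q.surjective_rangeRestrict (f.codRestrict _ fun x => hf (LinearMap.mem_range_self f x))
  exact ⟨g, LinearMap.ext fun x => congrArg Subtype.val (LinearMap.congr_fun hg x)⟩

theorem prodM_annMr {R : Type u} [Ring R] {M : Type v} [AddCommGroup M] [Module R M]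
    (hproj : ProjInSigma R M) (N : Submodule R M) : prodM R M N (annMr R M N) = ⊥ := by
  rw [prodM_eq_bot_iff_s15]
  intro f hf x hx
  let S := {L : Submodule R M | prodM R M N L = ⊥}
  let A : Submodule R (S →₀ M) := ⨅ i : S, (i : Submodule R M).comap (Finsupp.lapply i)
  let q : (S →₀ M) →ₗ[R] M := Finsupp.lsum ℕ fun _ => LinearMap.id
  have hq : LinearMap.range f ≤ LinearMap.range (q.comp A.subtype) := by
    refine hf.trans (sSup_le fun L hL y hy => ?_)
    refine ⟨⟨Finsupp.single ⟨L, hL⟩ y, ?_⟩, by simp [q]⟩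
    simp only [A, Submodule.mem_iInf, Submodule.mem_comap, Finsupp.lapply_apply]
    intro i
    by_cases h : ⟨L, hL⟩ = i
    · subst h
      simpa using hy
    · simp [Finsupp.single_eq_of_ne' h]
  obtain ⟨g, rfl⟩ := hproj.exists_lift (inSigma_submodule_finsupp A) _ f hq
  have hzero : (g x : S →₀ M) = 0 := by
    ext i
    refine prodM_eq_bot_iff_s15.mp i.2 ((Finsupp.lapply i).comp (A.subtype.comp g)) ?_ x hx
    rintro _ ⟨y, rfl⟩
    exact (Submodule.mem_iInf _).mp (g y).2 i
  simp [hzero]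

theorem isFullyInvariant_annMr {R : Type u} [Ring R] {M : Type v} [AddCommGroup M]
    [Module R M] (hproj : ProjInSigma R M) (N : Submodule R M) :
    IsFullyInvariant R M (annMr R M N) := by
  intro g
  refine le_sSup (prodM_eq_bot_iff_s15.mpr fun f hf x hx => ?_)
  obtain ⟨h, rfl⟩ := hproj.exists_lift (inSigma_submodule (annMr R M N))
    (g.comp (annMr R M N).subtype) f (by simpa [LinearMap.range_comp] using hf)
  have hzero : (h x : M) = 0 :=
    prodM_eq_bot_iff_s15.mp (prodM_annMr hproj N) ((annMr R M N).subtype.comp h)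
      (by rintro _ ⟨y, rfl⟩; exact (h y).2) x hx
  simp [hzero]

theorem IsSemiprime.annMr_inf_eq_bot {R : Type u} [Ring R] {M : Type v} [AddCommGroup M]
    [Module R M] (hsemi : IsSemiprime R M) (hproj : ProjInSigma R M) (N : Submodule R M) :
    annMr R M N ⊓ N = ⊥ :=
  hsemi _ <| prodM_eq_bot_iff_s15.mpr fun f hf x hx =>
    prodM_eq_bot_iff_s15.mp (prodM_annMr hproj N) f (hf.trans inf_le_left) x hx.2

theorem PrimeIn.annMr_le {R : Type u} [Ring R] {M : Type v} [AddCommGroup M]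
    [Module R M] {P N : Submodule R M} (hP : PrimeIn R M P) (hproj : ProjInSigma R M)
    (hN : IsFullyInvariant R M N) (hNP : ¬ N ≤ P) : annMr R M N ≤ P :=
  (hP.2.2 N _ hN (isFullyInvariant_annMr hproj N)
    ((prodM_annMr hproj N).le.trans bot_le)).resolve_left hNP

/-- Proposition 2.17: the right annihilators of the minimal
primes form an independent family. -/
theorem stmt_15 (R : Type u) [Ring R] (M : Type v) [AddCommGroup M] [Module R M]
    (hproj : ProjInSigma R M) (hsemi : IsSemiprime R M)
    (hacc : AccOnAnnihilators R M)
    (n : ℕ) (P : Fin n → Submodule R M) (hinj : Function.Injective P)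
    (hmin : ∀ i, MinPrimeIn R M (P i))
    (hall : ∀ Q : Submodule R M, MinPrimeIn R M Q → ∃ i, Q = P i) :
    ∀ i : Fin n,
      annMr R M (P i) ⊓ (⨆ j ∈ {j : Fin n | j ≠ i}, annMr R M (P j)) = ⊥ := by
  intro i
  rw [eq_bot_iff, ← hsemi.annMr_inf_eq_bot hproj (P i)]
  refine inf_le_inf_left _ (iSup₂_le fun j hj => ?_)
  exact (hmin i).1.annMr_le hproj (hmin j).1.2.1 fun hle =>
    hj (hinj ((hmin i).2 _ (hmin j).1 hle))
end

section
/- Let M be an R-module projective in σ[M] with S = End_R(M), and suppose M is continuous, retractable, non M-singular, and satisfies ACC on annihilators. Then M is a semiprime Goldie module, i.e., M is semiprime, satisfies ACC on annihilators, and has finite uniform dimension. -/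
/- Common definitions: the category σ[M], projectivity in σ[M], the product
   K_M L of submodules, annihilators, prime/semiprime submodules, hereditary
   torsion theories, M-singular modules, etc., following the paper. -/

universe u v

section Continuous

variable {R : Type u} [Ring R] {M : Type v} [AddCommGroup M] [Module R M]

theorem inSigma_submodule_s19 (D : Submodule R M) : InSigma R M D :=
  ⟨PUnit, ⊥, (Submodule.mkQ ⊥).comp ((Finsupp.lsingle PUnit.unit).comp D.subtype), by
    have h : Function.Injective (Submodule.mkQ (⊥ : Submodule R (PUnit.{v + 1} →₀ M))) := by
      rw [← LinearMap.ker_eq_bot, Submodule.ker_mkQ]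
    exact h.comp ((Finsupp.single_injective _).comp D.injective_subtype)⟩

/-- If `ker f` is essential in `D`, then the image of `D` under `f` is `M`-singular. -/
theorem isMSingular_map (f : M →ₗ[R] M) (D : Submodule R M)
    (h : ∀ L : Submodule R M, L ≤ D → L ≠ ⊥ → LinearMap.ker f ⊓ L ≠ ⊥) :
    IsMSingular R M (D.map f) := by
  refine ⟨D, inferInstance, inferInstance, inSigma_submodule_s19 D,
    LinearMap.ker (f.domRestrict D), fun L hL h_inf => ?_, ⟨?_⟩⟩
  · refine h (L.map D.subtype) (Submodule.map_subtype_le D L) ?_ ?_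
    · exact fun h_bot => hL (Submodule.map_injective_of_injective D.injective_subtype
        (h_bot.trans (Submodule.map_bot _).symm))
    · rw [eq_bot_iff]
      rintro _ ⟨hx, y, hy, rfl⟩
      have : y ∈ LinearMap.ker (f.domRestrict D) ⊓ L := ⟨hx, hy⟩
      rw [h_inf, Submodule.mem_bot] at this
      simp [this]
  · exact ((LinearEquiv.ofEq _ _ (LinearMap.range_domRestrict D f).symm).trans
      (f.domRestrict D).quotKerEquivRange.symm)

/-- Ranges of endomorphisms of a continuous non `M`-singular module are direct summands. -/
theorem ContinuousModule.exists_isCompl_range (hcont : ContinuousModule R M)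
    (hns : singularSub R M = ⊥) (f : M →ₗ[R] M) :
    ∃ N, IsCompl (LinearMap.range f) N := by
  obtain ⟨D, ⟨D', hD⟩, h_le, h_ess⟩ := hcont.1 (LinearMap.ker f)
  have h_map : D.map f = ⊥ := by
    rw [eq_bot_iff, ← hns]
    exact le_sSup (isMSingular_map f D h_ess)
  have h_ker : D ≤ LinearMap.ker f := LinearMap.le_ker_iff_map.2 h_map
  obtain rfl := le_antisymm h_le h_ker
  refine hcont.2 _ D' ⟨_, hD.symm⟩ ⟨LinearEquiv.symm ?_⟩
  refine (LinearEquiv.ofInjective (f.domRestrict D') ?_).trans (LinearEquiv.ofEq _ _ ?_)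
  · rw [← LinearMap.ker_eq_bot, LinearMap.ker_eq_bot']
    intro x hx
    have : (x : M) ∈ LinearMap.ker f ⊓ D' := ⟨hx, x.2⟩
    rw [hD.inf_eq_bot, Submodule.mem_bot] at this
    exact Subtype.ext this
  · rw [LinearMap.range_domRestrict, LinearMap.range_eq_map, ← hD.sup_eq_top,
      Submodule.map_sup, h_map, bot_sup_eq]

theorem ContinuousModule.isSemiprime (hcont : ContinuousModule R M)
    (hretr : ∀ N : Submodule R M, N ≠ ⊥ → ∃ f : M →ₗ[R] ↥N, f ≠ 0)
    (hns : singularSub R M = ⊥) : IsSemiprime R M := by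
  intro K hK
  by_contra h_ne
  obtain ⟨f, hf⟩ := hretr K h_ne
  obtain ⟨N, hN⟩ := hcont.exists_isCompl_range hns (K.subtype.comp f)
  have h_le : LinearMap.range (K.subtype.comp f) ≤ K := by
    rintro _ ⟨x, rfl⟩
    exact (f x).2
  have h_proj : K.map (Submodule.projection _ _ hN) ≤ ⊥ := by
    rw [← hK]
    refine le_iSup₂_of_le (Submodule.projection _ _ hN) ?_ le_rfl
    rintro _ ⟨x, rfl⟩
    exact h_le (Submodule.projection_apply_mem hN x)
  refine hf (LinearMap.ext fun x => Subtype.ext ?_)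
  have h_mem : (f x : M) ∈ LinearMap.range (K.subtype.comp f) := ⟨x, rfl⟩
  have := h_proj (Submodule.mem_map_of_mem (f x).2)
  rwa [Submodule.projection_apply_left hN ⟨_, h_mem⟩, Submodule.mem_bot] at this

theorem ContinuousModule.finiteUniformDimension (hcont : ContinuousModule R M)
    (hacc : AccOnAnnihilators R M) : FiniteUniformDimension R M := by
  rintro ⟨f, h_ne, h_ind⟩
  let N : ℕ → Submodule R M := fun n => ⨆ m ∈ {m : ℕ | m < n}, f m
  have hN : Monotone N := fun a b hab =>
    biSup_mono fun m (hm : m < a) => lt_of_lt_of_le hm hab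
  obtain ⟨n, hn⟩ := hacc (fun n => ⨅ g ∈ {g : M →ₗ[R] M | N n ≤ LinearMap.ker g},
    LinearMap.ker g) (fun n => ⟨_, rfl⟩)
    (fun a b hab => biInf_mono fun g (hg : N b ≤ LinearMap.ker g) => (hN hab).trans hg)
  obtain ⟨D, ⟨D', hD⟩, h_le, h_ess⟩ := hcont.1 (N n)
  have h_ker : LinearMap.ker (Submodule.projection _ _ hD.symm) = D := Submodule.ker_projection hD.symm
  have h_fn : f n ≤ D :=
    calc f n ≤ N (n + 1) := le_iSup₂_of_le n n.lt_succ_self le_rfl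
      _ ≤ ⨅ g ∈ {g : M →ₗ[R] M | N (n + 1) ≤ LinearMap.ker g}, LinearMap.ker g :=
        le_iInf₂ fun _ hg => hg
      _ = ⨅ g ∈ {g : M →ₗ[R] M | N n ≤ LinearMap.ker g}, LinearMap.ker g :=
        hn (n + 1) n.le_succ
      _ ≤ D := iInf₂_le_of_le (Submodule.projection _ _ hD.symm) (h_le.trans h_ker.ge) h_ker.le
  refine h_ess (f n) h_fn (h_ne n) ?_
  rw [eq_bot_iff, ← h_ind n, inf_comm]
  exact inf_le_inf_left _ (biSup_mono fun m (hm : m < n) => hm.ne)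

end Continuous

/-- Theorem 3.6: a continuous, retractable, non `M`-singular
module with ACC on annihilators is a semiprime Goldie module. -/
theorem stmt_19 (R : Type u) [Ring R] (M : Type v) [AddCommGroup M] [Module R M]
    (hproj : ProjInSigma R M) (hcont : ContinuousModule R M)
    (hretr : ∀ N : Submodule R M, N ≠ ⊥ → ∃ f : M →ₗ[R] ↥N, f ≠ 0)
    (hns : singularSub R M = ⊥) (hacc : AccOnAnnihilators R M) :
    IsSemiprime R M ∧ AccOnAnnihilators R M ∧ FiniteUniformDimension R M := by
  exact ⟨hcont.isSemiprime hretr hns, hacc, hcont.finiteUniformDimension hacc⟩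
end
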